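/- Let a > 0, m ≥ 0 an integer, and r > 0 such that ar is not a zero of J_m. Let (z_{mn})_{n≥1} be the increasing sequence of positive zeros of J_m and ρ_{nm} = z_{mn}/a. Then for almost every s ∈ [0, a], J_m(rs) = √2 J_m(ar) Σ_{n=1}^∞ (−1)^n ρ_{nm} · 𝒥_{nm}^a(s) / (r² − ρ_{nm}²), where 𝒥_{nm}^a(s) = J_m(ρ_{nm} s)/√(N_n^{(m)}(a)) with N_n^{(m)}(a) = (a²/2)J_m'(z_{mn})², the convergence being in L²([0,a], r dr). -/

import Mathlib

open MeasureTheory Filter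

/-- The Bessel function of the first kind of integer order `m`, via Bessel's
integral representation `J_m(x) = (1/π) ∫₀^π cos (m τ − x sin τ) dτ`. -/
noncomputable def besselJ (m : ℤ) (x : ℝ) : ℝ :=
  (1 / Real.pi) * ∫ τ in (0:ℝ)..Real.pi, Real.cos (m * τ - x * Real.sin τ)

lemma hasDerivAt_param (F F' : ℝ → ℝ → ℝ) (b : ℝ) (hF : ∀ x, Continuous (F x)) (hF' : ∀ x, Continuous (F' x))
    (hd : ∀ x t, HasDerivAt (fun x => F x t) (F' x t) x) (hb : ∀ x t, |F' x t| ≤ 1) (x : ℝ) :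
    HasDerivAt (fun x => ∫ t in (0:ℝ)..b, F x t) (∫ t in (0:ℝ)..b, F' x t) x := by
  refine (intervalIntegral.hasDerivAt_integral_of_dominated_loc_of_deriv_le (F := F) (F' := F')
    (bound := fun _ => 1) (s := Set.univ) Filter.univ_mem ?_ ?_ ?_ ?_ ?_ ?_).2
  · exact Filter.Eventually.of_forall fun y => (hF y).aestronglyMeasurable
  · exact (hF x).intervalIntegrable _ _
  · exact (hF' x).aestronglyMeasurable
  · exact Filter.Eventually.of_forall fun t _ y _ => hb y t
  · exact intervalIntegrable_const
  · exact Filter.Eventually.of_forall fun t _ y _ => hd y t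

noncomputable def bP (m : ℕ) (x : ℝ) : ℝ :=
  ∫ t in (0:ℝ)..Real.pi, Real.cos (x * Real.cos t) * Real.sin t ^ (2 * m)

lemma bP_deriv_int (m : ℕ) (x : ℝ) : HasDerivAt (bP m)
    (∫ t in (0:ℝ)..Real.pi, - (Real.sin (x * Real.cos t) * Real.cos t) * Real.sin t ^ (2 * m)) x := by
  refine hasDerivAt_param (fun x t => Real.cos (x * Real.cos t) * Real.sin t ^ (2 * m))
    (fun x t => - (Real.sin (x * Real.cos t) * Real.cos t) * Real.sin t ^ (2 * m)) Real.pi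
    (fun x => by fun_prop) (fun x => by fun_prop) ?_ ?_ x
  · intro y t
    have : HasDerivAt (fun y => y * Real.cos t) (Real.cos t) y := by simpa using (hasDerivAt_id y).mul_const (Real.cos t)
    have h := (this.cos).mul_const (Real.sin t ^ (2*m))
    rw [neg_mul] at h
    exact h
  · intro y t
    rw [abs_mul, abs_neg, abs_mul, abs_pow]
    have h1 := Real.abs_sin_le_one (y * Real.cos t)
    have h2 := Real.abs_cos_le_one t
    have h3 : |Real.sin t| ^ (2*m) ≤ 1 := pow_le_one₀ (abs_nonneg _) (Real.abs_sin_le_one t)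
    exact mul_le_one₀ (mul_le_one₀ h1 (abs_nonneg _) h2) (by positivity) h3

lemma bP_int_eq (m : ℕ) (x : ℝ) : (∫ t in (0:ℝ)..Real.pi, - (Real.sin (x * Real.cos t) * Real.cos t) * Real.sin t ^ (2 * m))
    = -(x / (2 * m + 1)) * bP (m+1) x := by
  have h2 := intervalIntegral.integral_mul_deriv_eq_deriv_mul (a := 0) (b := Real.pi)
    (u := fun t => Real.sin (x * Real.cos t)) (u' := fun t => Real.cos (x * Real.cos t) * (x * (-Real.sin t)))
    (v := fun t => Real.sin t ^ (2 * m + 1)) (v' := fun t => ((2 * m + 1 : ℕ) : ℝ) * Real.sin t ^ (2 * m) * Real.cos t)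
    (fun t _ => ((Real.hasDerivAt_cos t).const_mul x).sin)
    (fun t _ => (Real.hasDerivAt_sin t).pow (2 * m + 1))
    (Continuous.intervalIntegrable (by fun_prop) _ _)
    (Continuous.intervalIntegrable (by fun_prop) _ _)
  have hne : (2 * (m:ℝ) + 1) ≠ 0 := by positivity
  have e1 : ∫ t in (0:ℝ)..Real.pi, Real.sin (x * Real.cos t) * (((2 * m + 1 : ℕ) : ℝ) * Real.sin t ^ (2 * m) * Real.cos t)
     = -(2 * m + 1) * ∫ t in (0:ℝ)..Real.pi, - (Real.sin (x * Real.cos t) * Real.cos t) * Real.sin t ^ (2 * m) := by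
    rw [← intervalIntegral.integral_const_mul]; congr 1; ext t; push_cast; ring
  have e2 : ∫ t in (0:ℝ)..Real.pi, Real.cos (x * Real.cos t) * (x * (-Real.sin t)) * Real.sin t ^ (2 * m + 1)
     = - x * bP (m+1) x := by
    rw [bP, ← intervalIntegral.integral_const_mul]; congr 1; ext t; ring
  rw [e1, e2] at h2
  simp only [Real.sin_pi, Real.sin_zero, zero_pow (Nat.succ_ne_zero _), mul_zero] at h2
  generalize (∫ t in (0:ℝ)..Real.pi, - (Real.sin (x * Real.cos t) * Real.cos t) * Real.sin t ^ (2 * m)) = I at h2 ⊢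
  field_simp
  linarith

/-- derivative of `bP` -/
noncomputable def bP' (m : ℕ) (x : ℝ) : ℝ := -(x / (2 * m + 1)) * bP (m+1) x

lemma bP_hd (m : ℕ) (x : ℝ) : HasDerivAt (bP m) (bP' m x) x := by
  have := bP_deriv_int m x
  rwa [bP_int_eq] at this

lemma bP_cont (m : ℕ) : Continuous (bP m) :=
  continuous_iff_continuousAt.2 fun x => (bP_hd m x).continuousAt

lemma bP'_cont (m : ℕ) : Continuous (bP' m) := by
  have := bP_cont (m+1)
  unfold bP'; fun_prop

lemma bP_succ (m : ℕ) (x : ℝ) : bP' (m+1) x * x = (2 * m + 1) * bP m x - (2 * m + 2) * bP (m+1) x := by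
  rw [bP', ← bP_int_eq]
  have h2 := intervalIntegral.integral_mul_deriv_eq_deriv_mul (a := 0) (b := Real.pi)
    (v := fun t => Real.cos (x * Real.cos t)) (v' := fun t => - Real.sin (x * Real.cos t) * (x * (-Real.sin t)))
    (u := fun t => Real.cos t * Real.sin t ^ (2 * m + 1))
    (u' := fun t => -Real.sin t * Real.sin t ^ (2 * m + 1) + Real.cos t * (((2 * m + 1 : ℕ) : ℝ) * Real.sin t ^ (2 * m) * Real.cos t))
    (fun t _ => (Real.hasDerivAt_cos t).mul ((Real.hasDerivAt_sin t).pow (2 * m + 1)))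
    (fun t _ => ((Real.hasDerivAt_cos t).const_mul x).cos)
    (Continuous.intervalIntegrable (by fun_prop) _ _)
    (Continuous.intervalIntegrable (by fun_prop) _ _)
  simp only [Real.sin_pi, Real.sin_zero, zero_pow (Nat.succ_ne_zero _), mul_zero, zero_mul, sub_zero, zero_sub] at h2
  have e1 : ∫ t in (0:ℝ)..Real.pi, Real.cos t * Real.sin t ^ (2 * m + 1) * (- Real.sin (x * Real.cos t) * (x * (-Real.sin t)))
      = - ((∫ t in (0:ℝ)..Real.pi, - (Real.sin (x * Real.cos t) * Real.cos t) * Real.sin t ^ (2 * (m+1))) * x) := by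
    rw [← intervalIntegral.integral_mul_const, ← intervalIntegral.integral_neg]; congr 1; ext t; ring
  have e2 : ∫ t in (0:ℝ)..Real.pi, (-Real.sin t * Real.sin t ^ (2 * m + 1) + Real.cos t * (((2 * m + 1 : ℕ) : ℝ) * Real.sin t ^ (2 * m) * Real.cos t)) * Real.cos (x * Real.cos t)
     = (2 * m + 1) * bP m x - (2 * m + 2) * bP (m+1) x := by
    rw [bP, bP, ← intervalIntegral.integral_const_mul, ← intervalIntegral.integral_const_mul, ← intervalIntegral.integral_sub
      (Continuous.intervalIntegrable (by fun_prop) _ _) (Continuous.intervalIntegrable (by fun_prop) _ _)]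
    congr 1; ext t
    have : Real.cos t * (((2 * m + 1 : ℕ) : ℝ) * Real.sin t ^ (2 * m) * Real.cos t) =
      (1 - Real.sin t ^ 2) * ((2 * m + 1) * Real.sin t ^ (2 * m)) := by
      rw [← Real.cos_sq']; push_cast; ring
    rw [this]; ring
  rw [e1, e2] at h2
  linarith

lemma bP'_hd (m : ℕ) (x : ℝ) (hx : x ≠ 0): HasDerivAt (bP' m) (- bP m x - (2 * m + 1) / x * bP' m x) x := by
  have h := (((hasDerivAt_id x).div_const (2 * (m:ℝ) + 1)).neg).mul (bP_hd (m+1) x)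
  refine h.congr_deriv ?_
  have := bP_succ m x
  have hne : (2 * (m:ℝ) + 1) ≠ 0 := by positivity
  have e : -(x / (2 * (m:ℝ) + 1)) * bP' (m+1) x = - (bP m x) + (2 * m + 2) / (2 * m + 1) * bP (m+1) x := by
    field_simp; linarith
  change -(1 / (2 * (m:ℝ) + 1)) * bP (m+1) x + -(x / (2 * (m:ℝ) + 1)) * bP' (m+1) x = _
  rw [e, bP']
  field_simp
  ring

lemma bP_zero_pos (m : ℕ) : 0 < bP m 0 := by
  simp only [bP, zero_mul, Real.cos_zero, one_mul]
  exact integral_sin_pow_pos _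

lemma besselJ_hd (m : ℕ) (x : ℝ) : HasDerivAt (besselJ m)
    ((1 / Real.pi) * ∫ t in (0:ℝ)..Real.pi, Real.sin (m * t - x * Real.sin t) * Real.sin t) x := by
  have := (hasDerivAt_param (fun x t => Real.cos (m * t - x * Real.sin t))
    (fun x t => Real.sin (m * t - x * Real.sin t) * Real.sin t) Real.pi
    (fun x => by fun_prop) (fun x => by fun_prop) ?_ ?_ x).const_mul (1 / Real.pi)
  · exact this
  · intro y t
    have h : HasDerivAt (fun y => m * t - y * Real.sin t) (- Real.sin t) y := by
      simpa using ((hasDerivAt_id y).mul_const (Real.sin t)).const_sub (m * t)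
    simpa using h.cos
  · intro y t
    rw [abs_mul]
    exact mul_le_one₀ (Real.abs_sin_le_one _) (abs_nonneg _) (Real.abs_sin_le_one _)

lemma besselJ_rec (m : ℕ) (x : ℝ) : x * besselJ (m+1 : ℕ) x = m * besselJ m x - x * deriv (besselJ m) x := by
  rw [(besselJ_hd m x).deriv]
  have h := intervalIntegral.integral_eq_sub_of_hasDerivAt (a := 0) (b := Real.pi)
    (f := fun t => Real.sin (m * t - x * Real.sin t)) (f' := fun t => Real.cos (m * t - x * Real.sin t) * (m - x * Real.cos t))
    (fun t _ => by
      have : HasDerivAt (fun t => m * t - x * Real.sin t) (m - x * Real.cos t) t := by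
        exact (((hasDerivAt_id t).const_mul (m:ℝ)).sub ((Real.hasDerivAt_sin t).const_mul x)).congr_deriv (by simp)
      exact this.sin)
    (Continuous.intervalIntegrable (by fun_prop) _ _)
  simp only [Real.sin_pi, Real.sin_zero, mul_zero, sub_zero, Real.sin_nat_mul_pi] at h
  have e : ∀ y : ℝ, m * y = y * m := fun y => mul_comm _ _
  have : (∫ t in (0:ℝ)..Real.pi, x * Real.cos ((m + 1) * t - x * Real.sin t)) =
      (∫ t in (0:ℝ)..Real.pi, m * Real.cos (m * t - x * Real.sin t)) - (∫ t in (0:ℝ)..Real.pi, x * (Real.sin (m * t - x * Real.sin t) * Real.sin t))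
       - ∫ t in (0:ℝ)..Real.pi, Real.cos (m * t - x * Real.sin t) * (m - x * Real.cos t) := by
    rw [← intervalIntegral.integral_sub
      (Continuous.intervalIntegrable (by fun_prop) _ _) (Continuous.intervalIntegrable (by fun_prop) _ _), ← intervalIntegral.integral_sub
      (Continuous.intervalIntegrable (by fun_prop) _ _) (Continuous.intervalIntegrable (by fun_prop) _ _)]
    congr 1; ext t
    have : (m + 1) * t - x * Real.sin t = (m * t - x * Real.sin t) + t := by ring
    rw [this, Real.cos_add]; ring
  rw [h, intervalIntegral.integral_const_mul, intervalIntegral.integral_const_mul, intervalIntegral.integral_const_mul] at this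
  simp only [besselJ]
  push_cast
  linear_combination (1 / Real.pi) * this

lemma besselJ_eq (m : ℕ) : ∃ c : ℝ, 0 < c ∧ ∀ x, besselJ m x = c * x ^ m * bP m x := by
  induction m with
  | zero =>
    refine ⟨1 / Real.pi, by positivity, fun x => ?_⟩
    simp only [besselJ, bP]
    simp only [Nat.cast_zero, Int.cast_zero, zero_mul, zero_sub, Real.cos_neg, pow_zero, mul_one, mul_zero]
    congr 1
    have hp : Function.Periodic (fun t => Real.cos (x * Real.sin t)) Real.pi := by
      intro t; simp [Real.sin_add_pi]
    have h1 := hp.intervalIntegral_add_eq 0 (Real.pi / 2)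
    rw [zero_add] at h1
    rw [h1]
    have h2 := intervalIntegral.integral_comp_add_right (a := 0) (b := Real.pi) (fun t => Real.cos (x * Real.sin t)) (Real.pi / 2)
    rw [zero_add, add_comm Real.pi] at h2
    rw [← h2]
    simp [Real.sin_add_pi_div_two]
  | succ m ih =>
    obtain ⟨c, hc, h⟩ := ih
    refine ⟨c / (2 * m + 1), by positivity, fun x => ?_⟩
    have key : ∀ x ≠ 0, besselJ (m+1 : ℕ) x = c / (2 * m + 1) * x ^ (m+1) * bP (m+1) x := by
      intro x hx
      have hr := besselJ_rec m x
      have hf : besselJ m = fun x => c * x ^ m * bP m x := funext h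
      have hd : HasDerivAt (besselJ m) (c * (m * x ^ (m-1)) * bP m x + c * x ^ m * bP' m x) x := by
        rw [hf]
        exact ((hasDerivAt_pow m x).const_mul c).mul (bP_hd m x)
      rw [hd.deriv, h, bP'] at hr
      have hm : x * (m * x ^ (m-1)) = m * x ^ m := by
        cases m with
        | zero => simp
        | succ k => simp [pow_succ]; ring
      apply mul_left_cancel₀ hx
      rw [hr]
      linear_combination (-c * bP m x) * hm
    have hc1 : Continuous (besselJ (m+1 : ℕ)) :=
      continuous_iff_continuousAt.2 fun x => (besselJ_hd (m+1) x).continuousAt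
    have hc2 : Continuous (fun x => c / (2 * m + 1) * x ^ (m+1) * bP (m+1) x) := by
      have := bP_cont (m+1)
      fun_prop
    have := Continuous.ext_on (dense_compl_singleton (0:ℝ)) hc1 hc2 (fun x hx => key x hx)
    exact congrFun this x
lemma bP_simple (m : ℕ) (x : ℝ) (hx : 0 < x) (h0 : bP m x = 0) : bP' m x ≠ 0 := by
  intro h1
  set F : ℝ → ℝ := fun y => y ^ (4 * m + 2) * (bP m y ^ 2 + bP' m y ^ 2) with hF
  have hder : ∀ y, 0 < y → HasDerivAt F ((4 * m + 2) * y ^ (4 * m + 1) * bP m y ^ 2) y := by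
    intro y hy
    have h := (hasDerivAt_pow (4 * m + 2) y).mul (((bP_hd m y).pow 2).add ((bP'_hd m y hy.ne').pow 2))
    refine h.congr_deriv ?_
    simp only [Pi.add_apply, Pi.pow_apply]
    have e : y ^ (4 * m + 2) = y ^ (4 * m + 1) * y := pow_succ _ _
    rw [e]
    push_cast
    field_simp
    ring
  have hcont : Continuous F := by
    have := bP_cont m
    have := bP'_cont m
    fun_prop
  have hmono : MonotoneOn F (Set.Icc 0 x) := by
    apply monotoneOn_of_deriv_nonneg (convex_Icc 0 x) hcont.continuousOn
    · intro y hy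
      rw [interior_Icc] at hy
      exact (hder y hy.1).differentiableAt.differentiableWithinAt
    · intro y hy
      rw [interior_Icc] at hy
      rw [(hder y hy.1).deriv]
      have := hy.1
      positivity
  have hz : ∀ y ∈ Set.Ioo 0 x, bP m y = 0 := by
    intro y hy
    have h2 := hmono ⟨hy.1.le, hy.2.le⟩ ⟨hx.le, le_rfl⟩ hy.2.le
    have h3 : F x = 0 := by simp [hF, h0, h1]
    rw [h3] at h2
    have h4 : 0 < y ^ (4 * m + 2) := by have := hy.1; positivity
    have h5 : bP m y ^ 2 + bP' m y ^ 2 ≤ 0 := by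
      by_contra hc
      push Not at hc
      have := mul_pos h4 hc
      simp only [hF] at h2
      linarith
    have : bP m y ^ 2 ≤ 0 := by nlinarith [sq_nonneg (bP' m y)]
    exact pow_eq_zero_iff (two_ne_zero) |>.1 (le_antisymm this (sq_nonneg _))
  have h6 : ∀ᶠ y in nhdsWithin (0:ℝ) (Set.Ioi 0), bP m y = 0 := by
    filter_upwards [Ioo_mem_nhdsGT hx] with y hy using hz y hy
  have h7 : Tendsto (bP m) (nhdsWithin (0:ℝ) (Set.Ioi 0)) (nhds (bP m 0)) :=
    (bP_cont m).continuousAt.tendsto.mono_left nhdsWithin_le_nhds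
  have h8 : Tendsto (bP m) (nhdsWithin (0:ℝ) (Set.Ioi 0)) (nhds 0) :=
    tendsto_const_nhds.congr' (h6.mono fun y hy => hy.symm)
  have := tendsto_nhds_unique h7 h8
  exact (bP_zero_pos m).ne' this

lemma z_tendsto (m : ℕ) (z : ℕ → ℝ) (hmono : StrictMono z) (hpos : ∀ n, 0 < z n)
    (hzero : ∀ n, bP m (z n) = 0) (hall : ∀ x, 0 < x → bP m x = 0 → ∃ n, x = z n) :
    Tendsto z atTop atTop := by
  rcases tendsto_atTop_of_monotone hmono.monotone with h | ⟨l, hl⟩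
  · exact h
  · exfalso
    have hle : ∀ n, z n ≤ l := fun n => hmono.monotone.ge_of_tendsto hl n
    have h1 : Tendsto (fun n => bP m (z n)) atTop (nhds (bP m l)) :=
      ((bP_cont m).tendsto l).comp hl
    simp only [hzero] at h1
    have h2 := tendsto_nhds_unique tendsto_const_nhds h1
    obtain ⟨n, hn⟩ := hall l ((hpos 0).trans_le (hle 0)) h2.symm
    have := hmono (Nat.lt_succ_self n)
    have := hle (n+1)
    simp at *
    linarith

lemma deriv_left (f : ℝ → ℝ) (f' u v : ℝ) (huv : u < v) (hf : HasDerivAt f f' v) (h0 : f v = 0)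
    (hp : ∀ y ∈ Set.Ioo u v, 0 < f y) : f' ≤ 0 := by
  have h := hasDerivAt_iff_tendsto_slope.1 hf
  have h2 : Tendsto (slope f v) (nhdsWithin v (Set.Iio v)) (nhds f') :=
    h.mono_left (nhdsWithin_mono _ fun y hy => ne_of_lt hy)
  refine le_of_tendsto h2 ?_
  filter_upwards [Ioo_mem_nhdsLT huv] with y hy
  rw [slope_def_field, h0, sub_zero]
  exact div_nonpos_of_nonneg_of_nonpos (hp y hy).le (by linarith [hy.2])

lemma exists_right (f : ℝ → ℝ) (f' u v : ℝ) (huv : u < v) (hf : HasDerivAt f f' u) (h0 : f u = 0)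
    (hp : 0 < f') : ∃ y ∈ Set.Ioo u v, 0 < f y := by
  have h := hasDerivAt_iff_tendsto_slope.1 hf
  have h2 : Tendsto (slope f u) (nhdsWithin u (Set.Ioi u)) (nhds f') :=
    h.mono_left (nhdsWithin_mono _ fun y hy => ne_of_gt hy)
  have h3 := (h2.eventually (lt_mem_nhds hp)).and (Ioo_mem_nhdsGT huv)
  obtain ⟨y, hy1, hy2⟩ := h3.exists
  refine ⟨y, hy2, ?_⟩
  rw [slope_def_field, h0, sub_zero] at hy1
  have : 0 < y - u := by linarith [hy2.1]
  exact (div_pos_iff_of_pos_right this).1 hy1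

lemma pos_on (f : ℝ → ℝ) (hf : Continuous f) (u v y : ℝ) (hy : y ∈ Set.Ioo u v) (hp : 0 < f y)
    (hne : ∀ x ∈ Set.Ioo u v, f x ≠ 0) : ∀ x ∈ Set.Ioo u v, 0 < f x := by
  intro x hx
  by_contra hc
  push Not at hc
  have := (isPreconnected_Ioo (a := u) (b := v)).intermediate_value hx hy hf.continuousOn
  obtain ⟨w, hw, hw0⟩ := this ⟨hc, hp.le⟩
  exact hne w hw hw0

lemma bP_sign (m : ℕ) (z : ℕ → ℝ) (hmono : StrictMono z) (hpos : ∀ n, 0 < z n)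
    (hzero : ∀ n, bP m (z n) = 0) (hall : ∀ x, 0 < x → bP m x = 0 → ∃ n, x = z n) (n : ℕ) :
    0 < (-1) ^ (n+1) * bP' m (z n) := by
  induction n with
  | zero =>
    have h1 : ∀ x ∈ Set.Ioo 0 (z 0), bP m x ≠ 0 := by
      intro x hx h
      obtain ⟨k, hk⟩ := hall x hx.1 h
      have := hmono.monotone (Nat.zero_le k)
      linarith [hx.2]
    have h2 : ∃ y ∈ Set.Ioo 0 (z 0), 0 < bP m y := by
      have e := ((bP_cont m).continuousAt (x := 0)).eventually (lt_mem_nhds (bP_zero_pos m))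
      obtain ⟨y, hy, hy'⟩ := ((e.filter_mono nhdsWithin_le_nhds).and (Ioo_mem_nhdsGT (hpos 0))).exists
      exact ⟨y, hy', hy⟩
    obtain ⟨y, hy, hy'⟩ := h2
    have h3 := pos_on _ (bP_cont m) _ _ y hy hy' h1
    have h4 := deriv_left _ _ _ _ (hpos 0) (bP_hd m (z 0)) (hzero 0) h3
    have h5 := lt_of_le_of_ne h4 (bP_simple m _ (hpos 0) (hzero 0))
    simp; exact h5
  | succ n ih =>
    have hlt := hmono (Nat.lt_succ_self n)
    have h1 : ∀ x ∈ Set.Ioo (z n) (z (n+1)), (-1) ^ (n+1) * bP m x ≠ 0 := by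
      intro x hx h
      have h' : bP m x = 0 := by simpa using h
      obtain ⟨k, hk⟩ := hall x ((hpos n).trans hx.1) h'
      rw [hk] at hx
      have a1 := hmono.lt_iff_lt.1 hx.1
      have a2 := hmono.lt_iff_lt.1 hx.2
      omega
    obtain ⟨y, hy, hy'⟩ := exists_right (fun x => (-1) ^ (n+1) * bP m x) _ _ _ hlt ((bP_hd m (z n)).const_mul _) (by simp [hzero]) ih
    have h3 := pos_on (fun x => (-1) ^ (n+1) * bP m x) (by have := bP_cont m; fun_prop) _ _ y hy hy' h1
    have h4 := deriv_left _ _ _ _ hlt ((bP_hd m (z (n+1))).const_mul ((-1) ^ (n+1))) (by simp [hzero]) h3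
    have h5 := lt_of_le_of_ne h4 (by simpa using bP_simple m _ (hpos (n+1)) (hzero (n+1)))
    rw [pow_succ]; linarith
section abstract_part
variable {V : Type*} [AddCommGroup V] [Module ℝ V]

lemma minmax (B Q : V →ₗ[ℝ] V →ₗ[ℝ] ℝ) (V0 : Submodule ℝ V) (hBs : ∀ x y, B x y = B y x) (hQs : ∀ x y, Q x y = Q y x)
    (e : ℕ → V) (he : ∀ i, e i ∈ V0) (l : ℕ → ℝ) (hl : StrictMono l) (hB : ∀ i, 0 < B (e i) (e i))
    (horth : ∀ i j, i ≠ j → B (e i) (e j) = 0)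
    (hQ : ∀ x ∈ V0, ∀ i, Q x (e i) = l i * B x (e i)) (n : ℕ)
    (L : V →ₗ[ℝ] (Fin n → ℝ)) (hL : ∀ x ∈ V0, L x = 0 → l n * B x x ≤ Q x x)
    (g : V) (hg : g ∈ V0) (hgo : ∀ i < n, B g (e i) = 0) : l n * B g g ≤ Q g g := by
  classical
  let S : (ℝ × (Fin n → ℝ)) →ₗ[ℝ] V :=
    (LinearMap.toSpanSingleton ℝ V g).coprod (Fintype.linearCombination ℝ (fun i : Fin n => e i))
  have hker : LinearMap.ker (L ∘ₗ S) ≠ ⊥ := by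
    apply LinearMap.ker_ne_bot_of_finrank_lt
    simp
  obtain ⟨⟨c, d⟩, hx, hne⟩ := (Submodule.ne_bot_iff _).1 hker
  set y : V := ∑ i : Fin n, d i • e i with hy
  have hS : S (c, d) = c • g + y := by
    simp [S, Fintype.linearCombination_apply, hy]
  have hyV : y ∈ V0 := Submodule.sum_mem _ fun i _ => V0.smul_mem _ (he i)
  have h1 := hL (c • g + y) (V0.add_mem (V0.smul_mem c hg) hyV) (by rw [← hS]; exact hx)
  have hBgy : B g y = 0 := by
    simp only [hy, map_sum, map_smul]
    exact Finset.sum_eq_zero fun i _ => by rw [hgo i i.2]; simp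
  have hQgy : Q g y = 0 := by
    simp only [hy, map_sum, map_smul]
    exact Finset.sum_eq_zero fun i _ => by rw [hQ g hg, hgo i i.2]; simp
  have hye : ∀ i : Fin n, B y (e i) = d i * B (e i) (e i) := by
    intro i
    simp only [hy, map_sum, map_smul, LinearMap.sum_apply, LinearMap.smul_apply, smul_eq_mul]
    rw [Finset.sum_eq_single i]
    · intro j _ hj
      rw [horth j i (fun h => hj (Fin.ext h))]; simp
    · simp
  have hByy : B y y = ∑ i : Fin n, d i ^ 2 * B (e i) (e i) := by
    conv_lhs => rw [hy]
    rw [← hy, map_sum]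
    exact Finset.sum_congr rfl fun i _ => by rw [map_smul, hye, smul_eq_mul]; ring
  have hQyy : Q y y = ∑ i : Fin n, l i * (d i ^ 2 * B (e i) (e i)) := by
    conv_lhs => rw [hy]
    rw [← hy, map_sum]
    exact Finset.sum_congr rfl fun i _ => by rw [map_smul, hQ y hyV, hye, smul_eq_mul]; ring
  have hByg : B y g = 0 := by rw [hBs, hBgy]
  have hQyg : Q y g = 0 := by rw [hQs, hQgy]
  simp only [map_add, map_smul, LinearMap.add_apply, LinearMap.smul_apply, smul_eq_mul, hBgy, hQgy, hByg, hQyg] at h1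
  have h2 : ∀ i : Fin n, 0 ≤ (l n - l i) * (d i ^ 2 * B (e i) (e i)) := fun i =>
    mul_nonneg (sub_nonneg.2 (hl i.2).le) (mul_nonneg (sq_nonneg _) (hB i).le)
  have h3 : l n * B y y - Q y y = ∑ i : Fin n, (l n - l i) * (d i ^ 2 * B (e i) (e i)) := by
    rw [hByy, hQyy, Finset.mul_sum, ← Finset.sum_sub_distrib]
    exact Finset.sum_congr rfl fun i _ => by ring
  have h4 : 0 ≤ l n * B y y - Q y y := by rw [h3]; exact Finset.sum_nonneg fun i _ => h2 i
  by_cases hc : c = 0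
  · exfalso
    subst hc
    have h5 : ∑ i : Fin n, (l n - l i) * (d i ^ 2 * B (e i) (e i)) = 0 := by rw [← h3]; nlinarith
    rw [Finset.sum_eq_zero_iff_of_nonneg (fun i _ => h2 i)] at h5
    apply hne
    have : d = 0 := by
      ext i
      have h6 := h5 i (Finset.mem_univ _)
      have hb1 := (hB i).ne'
      have hb2 := (sub_pos.2 (hl i.2)).ne'
      have h7 := (mul_eq_zero.1 h6).resolve_left hb2
      exact pow_eq_zero_iff two_ne_zero |>.1 ((mul_eq_zero.1 h7).resolve_right hb1)
    rw [this]; rfl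
  · have hc2 : 0 < c ^ 2 := by positivity
    have : 0 ≤ c ^ 2 * (Q g g - l n * B g g) := by nlinarith
    nlinarith [(mul_nonneg_iff_of_pos_left hc2).1 this]

/-- residual -/
noncomputable def resid (B : V →ₗ[ℝ] V →ₗ[ℝ] ℝ) (e : ℕ → V) (k : ℕ) (f : V) : V :=
  f - ∑ i ∈ Finset.range k, (B f (e i) / B (e i) (e i)) • e i

lemma psd_two (B : V →ₗ[ℝ] V →ₗ[ℝ] ℝ) (hp : ∀ x, 0 ≤ B x x) (x y : V) :
    B (x + y) (x + y) ≤ 2 * B x x + 2 * B y y := by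
  have := hp (x - y)
  simp only [map_add, map_sub, LinearMap.add_apply, LinearMap.sub_apply] at *
  linarith

lemma abstract_conv (B Q : V →ₗ[ℝ] V →ₗ[ℝ] ℝ) (V0 : Submodule ℝ V) (hBs : ∀ x y, B x y = B y x) (hQs : ∀ x y, Q x y = Q y x)
    (hBp : ∀ x, 0 ≤ B x x) (hQp : ∀ x, 0 ≤ Q x x)
    (e : ℕ → V) (he : ∀ i, e i ∈ V0) (l : ℕ → ℝ) (hl : StrictMono l) (hlpos : ∀ i, 0 < l i) (hlt : Tendsto l atTop atTop)
    (hB : ∀ i, 0 < B (e i) (e i))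
    (hQ : ∀ x ∈ V0, ∀ i, Q x (e i) = l i * B x (e i))
    (hL : ∀ n : ℕ, ∃ L : V →ₗ[ℝ] (Fin n → ℝ), ∀ x ∈ V0, L x = 0 → l n * B x x ≤ Q x x)
    (f : V) (hf : ∀ ε > 0, ∃ h ∈ V0, B (f - h) (f - h) ≤ ε) :
    Tendsto (fun k => B (resid B e k f) (resid B e k f)) atTop (nhds 0) := by
  have horth : ∀ i j, i ≠ j → B (e i) (e j) = 0 := by
    intro i j hij
    have h1 := hQ (e i) (he i) j
    have h2 := hQ (e j) (he j) i
    rw [hQs, hBs] at h2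
    have : (l i - l j) * B (e i) (e j) = 0 := by linarith
    rcases mul_eq_zero.1 this with h | h
    · exact absurd (hl.injective (sub_eq_zero.1 h)) hij
    · exact h
  have ho : ∀ k f, ∀ j < k, B (resid B e k f) (e j) = 0 := by
    intro k f j hj
    simp only [resid, map_sub, map_sum, map_smul, LinearMap.sub_apply, LinearMap.sum_apply, LinearMap.smul_apply, smul_eq_mul]
    rw [Finset.sum_eq_single j]
    · rw [div_mul_cancel₀ _ (hB j).ne', sub_self]
    · intro i _ hij; rw [horth i j hij, mul_zero]
    · intro h; exact absurd (Finset.mem_range.2 hj) h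
  -- Pythagoras
  have hpy : ∀ k f, B (resid B e k f) (resid B e k f) ≤ B f f := by
    intro k f
    set R := resid B e k f with hR
    set s := ∑ i ∈ Finset.range k, (B f (e i) / B (e i) (e i)) • e i with hs
    have hfe : f = R + s := by simp [hR, hs, resid]
    have hRs : B R s = 0 := by
      rw [hs, map_sum]
      exact Finset.sum_eq_zero fun i hi => by rw [map_smul, ho k f i (Finset.mem_range.1 hi), smul_zero]
    have hsR : B s R = 0 := by rw [hBs, hRs]
    conv_rhs => rw [hfe]
    simp only [map_add, LinearMap.add_apply, hRs, hsR]
    linarith [hBp s]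
  have hpyQ : ∀ k, ∀ f ∈ V0, Q (resid B e k f) (resid B e k f) ≤ Q f f := by
    intro k f hf
    have hsV : ∑ i ∈ Finset.range k, (B f (e i) / B (e i) (e i)) • e i ∈ V0 :=
      Submodule.sum_mem _ fun i _ => V0.smul_mem _ (he i)
    have hRV : resid B e k f ∈ V0 := V0.sub_mem hf hsV
    set R := resid B e k f with hR
    set s := ∑ i ∈ Finset.range k, (B f (e i) / B (e i) (e i)) • e i with hs
    have hfe : f = R + s := by simp [hR, hs, resid]
    have hRs : Q R s = 0 := by
      rw [hs, map_sum]
      exact Finset.sum_eq_zero fun i hi => by rw [map_smul, hQ R hRV, ho k f i (Finset.mem_range.1 hi), mul_zero, smul_zero]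
    have hsR : Q s R = 0 := by rw [hQs, hRs]
    conv_rhs => rw [hfe]
    simp only [map_add, LinearMap.add_apply, hRs, hsR]
    linarith [hQp s]
  have hV0 : ∀ k, ∀ f ∈ V0, l k * B (resid B e k f) (resid B e k f) ≤ Q f f := by
    intro k f hf
    obtain ⟨L, hL⟩ := hL k
    have hsV : ∑ i ∈ Finset.range k, (B f (e i) / B (e i) (e i)) • e i ∈ V0 :=
      Submodule.sum_mem _ fun i _ => V0.smul_mem _ (he i)
    have hRV : resid B e k f ∈ V0 := V0.sub_mem hf hsV
    exact (minmax B Q V0 hBs hQs e he l hl hB horth hQ k L hL _ hRV (ho k f)).trans (hpyQ k f hf)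
  have hadd : ∀ k f g, resid B e k (f + g) = resid B e k f + resid B e k g := by
    intro k f g
    simp only [resid, map_add, LinearMap.add_apply, add_div, add_smul, Finset.sum_add_distrib]
    abel
  rw [Metric.tendsto_atTop]
  intro ε hε
  obtain ⟨h, hh, hfh⟩ := hf (ε / 8) (by positivity)
  obtain ⟨N, hN⟩ := eventually_atTop.1 (hlt.eventually_gt_atTop (8 * Q h h / ε))
  refine ⟨N, fun k hk => ?_⟩
  rw [Real.dist_eq, sub_zero, abs_of_nonneg (hBp _)]
  have h1 := psd_two B hBp (resid B e k h) (resid B e k (f - h))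
  rw [← hadd, add_sub_cancel] at h1
  have h2 := hpy k (f - h)
  have h3 := hV0 k h hh
  have h4 := hN k hk
  rw [div_lt_iff₀ hε] at h4
  have h5 : B (resid B e k h) (resid B e k h) ≤ ε / 8 := by
    by_contra hc
    push Not at hc
    have := mul_lt_mul_of_pos_left hc (hlpos k)
    linarith
  linarith

end abstract_part
lemma bP'_hd0 (m : ℕ) (x : ℝ) : HasDerivAt (bP' m) (- bP m x + bP (m+1) x) x := by
  have h := (((hasDerivAt_id x).div_const (2 * (m:ℝ) + 1)).neg).mul (bP_hd (m+1) x)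
  refine h.congr_deriv ?_
  have := bP_succ m x
  have hne : (2 * (m:ℝ) + 1) ≠ 0 := by positivity
  have e : -(x / (2 * (m:ℝ) + 1)) * bP' (m+1) x = - (bP m x) + (2 * m + 2) / (2 * m + 1) * bP (m+1) x := by
    field_simp; linarith
  change -(1 / (2 * (m:ℝ) + 1)) * bP (m+1) x + -(x / (2 * (m:ℝ) + 1)) * bP' (m+1) x = _
  rw [e]
  field_simp
  ring

lemma scale_hd (f : ℝ → ℝ) (f' ρ s : ℝ) (h : HasDerivAt f f' (ρ * s)) :
    HasDerivAt (fun s => f (ρ * s)) (ρ * f') s := by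
  have h1 : HasDerivAt (fun s => ρ * s) ρ s := by simpa using (hasDerivAt_id s).const_mul ρ
  exact (h.comp s h1).congr_deriv (mul_comm _ _)

lemma flux_hd (m : ℕ) (ρ s : ℝ) : HasDerivAt (fun s => s ^ (2 * m + 1) * (ρ * bP' m (ρ * s)))
    (-(ρ ^ 2 * (s ^ (2 * m + 1) * bP m (ρ * s)))) s := by
  have h := (hasDerivAt_pow (2 * m + 1) s).mul ((scale_hd _ _ ρ s (bP'_hd0 m (ρ * s))).const_mul ρ)
  refine h.congr_deriv ?_
  simp only [bP', Nat.add_sub_cancel]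
  push_cast
  field_simp
  ring

lemma norm_hd (m : ℕ) (ρ s : ℝ) (hρ : ρ ≠ 0) :
    HasDerivAt (fun s => s ^ (2 * m + 2) * (bP m (ρ * s) ^ 2 + bP' m (ρ * s) ^ 2) / 2
      + s ^ (2 * m + 1) * (bP m (ρ * s) * bP' m (ρ * s)) * (m / ρ))
    (s ^ (2 * m + 1) * (bP m (ρ * s) * bP m (ρ * s))) s := by
  have h1 := scale_hd _ _ ρ s (bP_hd m (ρ * s))
  have h2 := scale_hd _ _ ρ s (bP'_hd0 m (ρ * s))
  have h := (((hasDerivAt_pow (2 * m + 2) s).mul ((h1.pow 2).add (h2.pow 2))).div_const 2).add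
    (((hasDerivAt_pow (2 * m + 1) s).mul (h1.mul h2)).mul_const (m / ρ))
  refine h.congr_deriv ?_
  simp only [Pi.add_apply, Pi.pow_apply, Pi.mul_apply, bP', Nat.add_sub_cancel, show 2 * m + 2 - 1 = 2 * m + 1 by omega]
  push_cast
  field_simp
  ring

/-- C¹ functions -/
def C1 : Submodule ℝ (ℝ → ℝ) where
  carrier := {f | ContDiff ℝ 1 f}
  add_mem' := by
    intro f g hf hg
    rw [Set.mem_ofPred_eq] at *
    exact hf.add hg
  zero_mem' := by
    rw [Set.mem_ofPred_eq]
    exact contDiff_const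
  smul_mem' := by
    intro c f hf
    rw [Set.mem_ofPred_eq] at *
    exact hf.const_smul c

lemma C1.cd (u : C1) : ContDiff ℝ 1 u.1 := by
  have h : u.1 ∈ {f : ℝ → ℝ | ContDiff ℝ 1 f} := u.2
  rwa [Set.mem_ofPred_eq] at h

lemma C1.hd (u : C1) (s : ℝ) : HasDerivAt u.1 (deriv u.1 s) s :=
  ((C1.cd u).differentiable one_ne_zero s).hasDerivAt

lemma C1.cont (u : C1) : Continuous u.1 := (C1.cd u).continuous

lemma C1.cont' (u : C1) : Continuous (deriv u.1) := (C1.cd u).continuous_deriv le_rfl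

lemma C1.deriv_add (u v : C1) (s : ℝ) : deriv (u + v).1 s = deriv u.1 s + deriv v.1 s :=
  (((C1.hd u) s).add ((C1.hd v) s)).deriv

lemma C1.deriv_smul (c : ℝ) (v : C1) (s : ℝ) : deriv (c • v).1 s = c * deriv v.1 s :=
  (((C1.hd v) s).const_mul c).deriv

noncomputable def BB (a : ℝ) (m : ℕ) : C1 →ₗ[ℝ] C1 →ₗ[ℝ] ℝ :=
  LinearMap.mk₂ ℝ (fun u v : C1 => ∫ s in (0:ℝ)..a, s ^ (2 * m + 1) * (u.1 s * v.1 s))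
    (fun u v w => by
      have := (C1.cont u); have := (C1.cont v); have := (C1.cont w)
      rw [← intervalIntegral.integral_add (Continuous.intervalIntegrable (by fun_prop) _ _) (Continuous.intervalIntegrable (by fun_prop) _ _)]
      congr 1; ext s; change _ * ((u.1 s + v.1 s) * w.1 s) = _; ring)
    (fun c u v => by
      rw [smul_eq_mul, ← intervalIntegral.integral_const_mul]
      congr 1; ext s; change _ * ((c * u.1 s) * v.1 s) = _; ring)
    (fun u v w => by
      have := (C1.cont u); have := (C1.cont v); have := (C1.cont w)
      rw [← intervalIntegral.integral_add (Continuous.intervalIntegrable (by fun_prop) _ _) (Continuous.intervalIntegrable (by fun_prop) _ _)]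
      congr 1; ext s; change _ * (u.1 s * (v.1 s + w.1 s)) = _; ring)
    (fun c u v => by
      rw [smul_eq_mul, ← intervalIntegral.integral_const_mul]
      congr 1; ext s; change _ * (u.1 s * (c * v.1 s)) = _; ring)

noncomputable def QQ (a : ℝ) (m : ℕ) : C1 →ₗ[ℝ] C1 →ₗ[ℝ] ℝ :=
  LinearMap.mk₂ ℝ (fun u v : C1 => ∫ s in (0:ℝ)..a, s ^ (2 * m + 1) * (deriv u.1 s * deriv v.1 s))
    (fun u v w => by
      have := (C1.cont' u); have := (C1.cont' v); have := (C1.cont' w)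
      rw [← intervalIntegral.integral_add (Continuous.intervalIntegrable (by fun_prop) _ _) (Continuous.intervalIntegrable (by fun_prop) _ _)]
      congr 1; ext s; rw [C1.deriv_add]; ring)
    (fun c u v => by
      rw [smul_eq_mul, ← intervalIntegral.integral_const_mul]
      congr 1; ext s; rw [C1.deriv_smul]; ring)
    (fun u v w => by
      have := (C1.cont' u); have := (C1.cont' v); have := (C1.cont' w)
      rw [← intervalIntegral.integral_add (Continuous.intervalIntegrable (by fun_prop) _ _) (Continuous.intervalIntegrable (by fun_prop) _ _)]
      congr 1; ext s; rw [C1.deriv_add]; ring)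
    (fun c u v => by
      rw [smul_eq_mul, ← intervalIntegral.integral_const_mul]
      congr 1; ext s; rw [C1.deriv_smul]; ring)

lemma BB_apply (a : ℝ) (m : ℕ) (u v : C1) : BB a m u v = ∫ s in (0:ℝ)..a, s ^ (2 * m + 1) * (u.1 s * v.1 s) := rfl
lemma QQ_apply (a : ℝ) (m : ℕ) (u v : C1) : QQ a m u v = ∫ s in (0:ℝ)..a, s ^ (2 * m + 1) * (deriv u.1 s * deriv v.1 s) := rfl

/-- the scaled function `s ↦ bP m (ρ s)` -/
noncomputable def kf (m : ℕ) (ρ : ℝ) : C1 := ⟨fun s => bP m (ρ * s), by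
  change ContDiff ℝ 1 _
  have hd := fun s => scale_hd _ _ ρ s (bP_hd m (ρ * s))
  rw [contDiff_one_iff_deriv]
  refine ⟨fun s => (hd s).differentiableAt, ?_⟩
  have : deriv (fun s => bP m (ρ * s)) = fun s => ρ * bP' m (ρ * s) := funext fun s => (hd s).deriv
  rw [this]
  have := bP'_cont m
  fun_prop⟩

lemma kf_deriv (m : ℕ) (ρ s : ℝ) : deriv (kf m ρ).1 s = ρ * bP' m (ρ * s) :=
  (scale_hd _ _ ρ s (bP_hd m (ρ * s))).deriv

/-- evaluation -/
def ev (a : ℝ) : C1 →ₗ[ℝ] ℝ where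
  toFun u := u.1 a
  map_add' _ _ := rfl
  map_smul' _ _ := rfl

lemma QQ_kf (a : ℝ) (m : ℕ) (u : C1) (ρ : ℝ) :
    QQ a m u (kf m ρ) = a ^ (2 * m + 1) * (ρ * bP' m (ρ * a)) * u.1 a + ρ ^ 2 * BB a m u (kf m ρ) := by
  have h := intervalIntegral.integral_mul_deriv_eq_deriv_mul (a := 0) (b := a)
    (u := u.1) (u' := deriv u.1) (v := fun s => s ^ (2 * m + 1) * (ρ * bP' m (ρ * s)))
    (v' := fun s => -(ρ ^ 2 * (s ^ (2 * m + 1) * bP m (ρ * s))))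
    (fun s _ => (C1.hd u) s) (fun s _ => flux_hd m ρ s)
    ((C1.cont' u).intervalIntegrable _ _)
    (Continuous.intervalIntegrable (by have := bP_cont m; fun_prop) _ _)
  have e1 : ∫ s in (0:ℝ)..a, u.1 s * -(ρ ^ 2 * (s ^ (2 * m + 1) * bP m (ρ * s))) = - (ρ ^ 2 * BB a m u (kf m ρ)) := by
    rw [BB_apply, ← intervalIntegral.integral_const_mul, ← intervalIntegral.integral_neg]
    congr 1; ext s; simp only [kf]; ring
  have e2 : ∫ s in (0:ℝ)..a, deriv u.1 s * (s ^ (2 * m + 1) * (ρ * bP' m (ρ * s))) = QQ a m u (kf m ρ) := by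
    rw [QQ_apply]
    congr 1; ext s; rw [kf_deriv]; ring
  rw [e1, e2] at h
  simp only [zero_pow (Nat.succ_ne_zero _), zero_mul, mul_zero] at h
  linarith

lemma BB_symm (a : ℝ) (m : ℕ) (u v : C1) : BB a m u v = BB a m v u := by
  rw [BB_apply, BB_apply]; congr 1; ext s; ring
lemma QQ_symm (a : ℝ) (m : ℕ) (u v : C1) : QQ a m u v = QQ a m v u := by
  rw [QQ_apply, QQ_apply]; congr 1; ext s; ring
lemma BB_nonneg (a : ℝ) (ha : 0 < a) (m : ℕ) (u : C1) : 0 ≤ BB a m u u := by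
  rw [BB_apply]
  refine intervalIntegral.integral_nonneg ha.le fun s hs => mul_nonneg (pow_nonneg hs.1 _) (mul_self_nonneg _)
lemma QQ_nonneg (a : ℝ) (ha : 0 < a) (m : ℕ) (u : C1) : 0 ≤ QQ a m u u := by
  rw [QQ_apply]
  refine intervalIntegral.integral_nonneg ha.le fun s hs => mul_nonneg (pow_nonneg hs.1 _) (mul_self_nonneg _)

lemma BB_kf_self (a : ℝ) (m : ℕ) (ρ : ℝ) (hρ : ρ ≠ 0) (h0 : bP m (ρ * a) = 0) :
    BB a m (kf m ρ) (kf m ρ) = a ^ (2 * m + 2) * bP' m (ρ * a) ^ 2 / 2 := by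
  rw [BB_apply]
  have := intervalIntegral.integral_eq_sub_of_hasDerivAt (a := 0) (b := a) (fun s _ => norm_hd m ρ s hρ)
    (Continuous.intervalIntegrable (by have := bP_cont m; fun_prop) _ _)
  refine this.trans ?_
  simp [h0]

lemma BB_lommel (a : ℝ) (m : ℕ) (r ρ : ℝ) (h0 : bP m (ρ * a) = 0) :
    (r ^ 2 - ρ ^ 2) * BB a m (kf m r) (kf m ρ) = a ^ (2 * m + 1) * (ρ * bP' m (ρ * a)) * bP m (r * a) := by
  have h1 := QQ_kf a m (kf m r) ρ
  have h2 := QQ_kf a m (kf m ρ) r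
  rw [QQ_symm, BB_symm] at h2
  have e1 : (kf m r).1 a = bP m (r * a) := rfl
  have e2 : (kf m ρ).1 a = 0 := h0
  rw [e1] at h1
  rw [e2] at h2
  linarith

lemma jacobi (a : ℝ) (ha : 0 < a) (m : ℕ) (ρ : ℝ) (hρ : 0 < ρ) (v : C1) (hva : v.1 a = 0)
    (hv : ∀ s ∈ Set.Ioc 0 a, bP m (ρ * s) = 0 → v.1 s = 0) :
    ρ ^ 2 * BB a m v v ≤ QQ a m v v := by
  have hvc := (C1.cont v)
  have hvc' := (C1.cont' v)
  have hpc := bP_cont m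
  have hpc' := bP'_cont m
  set d : ℝ → ℝ := fun s => s ^ (2 * m + 1) * (deriv v.1 s * deriv v.1 s) - ρ ^ 2 * (s ^ (2 * m + 1) * (v.1 s * v.1 s)) with hd
  have hdc : Continuous d := by fun_prop
  set D : ℝ → ℝ := fun x => ∫ s in (0:ℝ)..x, d s with hD
  have hDd : ∀ s, HasDerivAt D (d s) s := fun s => (hdc.integral_hasStrictDerivAt 0 s).hasDerivAt
  have hDa : D a = QQ a m v v - ρ ^ 2 * BB a m v v := by
    rw [QQ_apply, BB_apply, ← intervalIntegral.integral_const_mul, ← intervalIntegral.integral_sub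
      (Continuous.intervalIntegrable (by fun_prop) _ _) (Continuous.intervalIntegrable (by fun_prop) _ _)]
  set W : ℝ → ℝ := fun s => s ^ (2 * m + 1) * (ρ * bP' m (ρ * s)) * v.1 s ^ 2 / bP m (ρ * s) with hW
  have hWd : ∀ s ∈ Set.Ioc 0 a, ∃ b, HasDerivAt W b s ∧ b ≤ d s := by
    intro s hs
    by_cases hk : bP m (ρ * s) = 0
    · refine ⟨s ^ (2 * m + 1) * (deriv v.1 s * deriv v.1 s), ?_, ?_⟩
      · have hvs := hv s hs hk
        have hp' := bP_simple m (ρ * s) (mul_pos hρ hs.1) hk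
        rw [hasDerivAt_iff_tendsto_slope]
        have t1 := hasDerivAt_iff_tendsto_slope.1 ((C1.hd v) s)
        have t2 := hasDerivAt_iff_tendsto_slope.1 (scale_hd _ _ ρ s (bP_hd m (ρ * s)))
        have t3 : Tendsto (fun s => s ^ (2 * m + 1) * (ρ * bP' m (ρ * s))) (nhdsWithin s {s}ᶜ)
            (nhds (s ^ (2 * m + 1) * (ρ * bP' m (ρ * s)))) :=
          Continuous.continuousAt (by fun_prop) |>.tendsto.mono_left nhdsWithin_le_nhds
        have hne : ρ * bP' m (ρ * s) ≠ 0 := mul_ne_zero hρ.ne' hp'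
        have t4 := (t3.mul (t1.pow 2)).div t2 hne
        have e : s ^ (2 * m + 1) * (ρ * bP' m (ρ * s)) * (deriv v.1 s) ^ 2 / (ρ * bP' m (ρ * s)) =
            s ^ (2 * m + 1) * (deriv v.1 s * deriv v.1 s) := by
          field_simp
        rw [e] at t4
        refine t4.congr' ?_
        filter_upwards [self_mem_nhdsWithin] with y hy
        have hy' : y - s ≠ 0 := sub_ne_zero.2 hy
        have hWs : W s = 0 := by simp [hW, hvs]
        rw [Pi.div_apply, slope_def_field, slope_def_field, slope_def_field, hWs, hvs, hk, sub_zero, sub_zero, sub_zero]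
        simp only [hW]
        by_cases hky : bP m (ρ * y) = 0
        · simp [hky]
        · field_simp
      · simp [hd, hv s hs hk]
    · have h1 := ((flux_hd m ρ s).mul (((C1.hd v) s).pow 2)).div (scale_hd _ _ ρ s (bP_hd m (ρ * s))) hk
      refine ⟨_, h1, ?_⟩
      rw [← sub_nonneg]
      have : 0 ≤ s ^ (2 * m + 1) * (deriv v.1 s - ρ * bP' m (ρ * s) * v.1 s / bP m (ρ * s)) ^ 2 :=
        mul_nonneg (pow_nonneg hs.1.le _) (sq_nonneg _)
      refine this.trans_eq ?_
      simp only [hd, Pi.pow_apply, Pi.mul_apply]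
      field_simp
      push_cast
      ring
  have hmono : MonotoneOn (D - W) (Set.Icc 0 a) := by
    apply monotoneOn_of_deriv_nonneg (convex_Icc 0 a)
    · intro s hs
      apply ContinuousAt.continuousWithinAt
      refine (hDd s).continuousAt.sub ?_
      rcases hs.1.eq_or_lt with h | h
      · have : bP m (ρ * s) ≠ 0 := by rw [← h, mul_zero]; exact (bP_zero_pos m).ne'
        exact ContinuousAt.div (Continuous.continuousAt (by fun_prop)) (Continuous.continuousAt (by fun_prop)) this
      · obtain ⟨b, hb, _⟩ := hWd s ⟨h, hs.2⟩
        exact hb.continuousAt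
    · intro s hs
      rw [interior_Icc] at hs
      obtain ⟨b, hb, _⟩ := hWd s ⟨hs.1, hs.2.le⟩
      exact ((hDd s).sub hb).differentiableAt.differentiableWithinAt
    · intro s hs
      rw [interior_Icc] at hs
      obtain ⟨b, hb, hb'⟩ := hWd s ⟨hs.1, hs.2.le⟩
      rw [((hDd s).sub hb).deriv]
      linarith
  have h := hmono ⟨le_rfl, ha.le⟩ ⟨ha.le, le_rfl⟩ ha.le
  have e1 : (D - W) 0 = 0 := by simp [hD, hW]
  have e2 : (D - W) a = D a := by simp [hW, hva]
  rw [e1, e2, hDa] at h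
  linarith

lemma approx_V0 (a : ℝ) (ha : 0 < a) (m : ℕ) (f : C1) (ε : ℝ) (hε : 0 < ε) :
    ∃ h ∈ LinearMap.ker (ev a), BB a m (f - h) (f - h) ≤ ε := by
  have hq : ∀ N : ℕ, ∃ q : C1, q.1 = fun s => f.1 a * (s / a) ^ N := fun N => ⟨⟨_, by
    change ContDiff ℝ 1 _
    fun_prop⟩, rfl⟩
  choose q hq using hq
  have hB : ∀ N, BB a m (q N) (q N) = f.1 a ^ 2 * a ^ (2 * m + 2) / (2 * m + 2 + 2 * N) := by
    intro N
    rw [BB_apply, hq]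
    have : ∀ s : ℝ, s ^ (2 * m + 1) * (f.1 a * (s / a) ^ N * (f.1 a * (s / a) ^ N)) = (f.1 a ^ 2 / a ^ (2 * N)) * s ^ (2 * m + 1 + 2 * N) := by
      intro s; rw [div_pow]; field_simp; ring
    simp only [this]
    rw [intervalIntegral.integral_const_mul, integral_pow]
    simp only [zero_pow (Nat.succ_ne_zero _), sub_zero]
    push_cast
    field_simp
    ring
  obtain ⟨N, hN⟩ := exists_nat_gt (f.1 a ^ 2 * a ^ (2 * m + 2) / ε)
  refine ⟨f - q N, ?_, ?_⟩
  · rw [LinearMap.mem_ker, map_sub]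
    change f.1 a - (q N).1 a = 0
    rw [hq]; simp [ha.ne']
  · rw [sub_sub_cancel, hB, div_le_iff₀ (by positivity)]
    rw [div_lt_iff₀ hε] at hN
    have : (0:ℝ) ≤ m := Nat.cast_nonneg m
    have : (0:ℝ) ≤ N := Nat.cast_nonneg N
    nlinarith

lemma conv_main (a : ℝ) (ha : 0 < a) (m : ℕ) (z : ℕ → ℝ) (hmono : StrictMono z) (hpos : ∀ n, 0 < z n)
    (hzero : ∀ n, bP m (z n) = 0) (hall : ∀ x, 0 < x → bP m x = 0 → ∃ n, x = z n) (f : C1) :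
    Tendsto (fun k => BB a m (resid (BB a m) (fun n => kf m (z n / a)) k f)
      (resid (BB a m) (fun n => kf m (z n / a)) k f)) atTop (nhds 0) := by
  have hza : ∀ n, z n / a * a = z n := fun n => div_mul_cancel₀ _ ha.ne'
  have hρ : ∀ n, 0 < z n / a := fun n => div_pos (hpos n) ha
  have hρm : StrictMono fun n => z n / a := fun i j h => (div_lt_div_iff_of_pos_right ha).2 (hmono h)
  refine abstract_conv (BB a m) (QQ a m) (LinearMap.ker (ev a)) (BB_symm a m) (QQ_symm a m)
    (BB_nonneg a ha m) (QQ_nonneg a ha m) _ ?_ (fun n => (z n / a) ^ 2) ?_ ?_ ?_ ?_ ?_ ?_ f (fun ε hε => approx_V0 a ha m f ε hε)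
  · intro n
    change bP m (z n / a * a) = 0
    rw [hza, hzero]
  · intro i j h
    exact pow_lt_pow_left₀ (hρm h) (hρ i).le two_ne_zero
  · intro n; have := hρ n; positivity
  · exact (tendsto_pow_atTop two_ne_zero).comp ((z_tendsto m z hmono hpos hzero hall).atTop_div_const ha)
  · intro n
    rw [BB_kf_self a m _ (hρ n).ne' (by rw [hza, hzero]), hza]
    have := bP_simple m (z n) (hpos n) (hzero n)
    positivity
  · intro x hx n
    have hx' : x.1 a = 0 := hx
    rw [QQ_kf, hx']; ring
  · intro n
    refine ⟨LinearMap.pi fun j : Fin n => ev (a * z j / z n), fun x hx hL => ?_⟩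
    have hx' : x.1 a = 0 := hx
    refine jacobi a ha m _ (hρ n) x hx' ?_
    intro s hs h0
    obtain ⟨j, hj⟩ := hall _ (mul_pos (hρ n) hs.1) h0
    have hs' : s = a * z j / z n := by
      rw [← hj]; have := (hpos n).ne'; field_simp
    have hjn : z j ≤ z n := by
      rw [← hj]
      calc z n / a * s ≤ z n / a * a := mul_le_mul_of_nonneg_left hs.2 (hρ n).le
        _ = z n := hza n
    rcases (hmono.le_iff_le.1 hjn).eq_or_lt with h | h
    · rw [hs', h, mul_div_cancel_right₀ _ (hpos n).ne', hx']
    · have := congrFun hL ⟨j, h⟩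
      rw [hs']; exact this

lemma eLpNorm_eq (a : ℝ) (ha : 0 < a) (F : ℝ → ℝ) (hF : Continuous F) :
    eLpNorm F 2 ((volume.restrict (Set.Ioc (0:ℝ) a)).withDensity (fun s => ENNReal.ofReal s))
      = (ENNReal.ofReal (∫ s in (0:ℝ)..a, s * F s ^ 2)) ^ (1 / 2 : ℝ) := by
  rw [eLpNorm_eq_lintegral_rpow_enorm_toReal two_ne_zero ENNReal.ofNat_ne_top]
  simp only [ENNReal.toReal_ofNat]
  congr 1
  rw [lintegral_withDensity_eq_lintegral_mul _ (by fun_prop) (by fun_prop)]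
  rw [intervalIntegral.integral_of_le ha.le, ofReal_integral_eq_lintegral_ofReal]
  · refine setLIntegral_congr_fun measurableSet_Ioc fun s hs => ?_
    simp only [Pi.mul_apply]
    rw [ENNReal.ofReal_mul hs.1.le]
    congr 1
    rw [ENNReal.rpow_ofNat, ← ofReal_norm, ← ENNReal.ofReal_pow (norm_nonneg _), Real.norm_eq_abs, sq_abs]
  · exact (Continuous.integrableOn_Icc (by fun_prop)).mono_set Set.Ioc_subset_Icc_self
  · filter_upwards [ae_restrict_mem measurableSet_Ioc] with s hs
    exact mul_nonneg hs.1.le (sq_nonneg _)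
/-- Fourier-Bessel expansion of `s ↦ J_m(rs)` on `[0,a]` (zero-value boundary
condition): the partial sums of
`√2 J_m(ar) Σₙ (−1)ⁿ ρₙ 𝒥ₙ(s) / (r² − ρₙ²)` converge to `J_m(r·)` in
`L²([0,a], s ds)`.  Here `z (n)` enumerates the increasing positive zeros of
`J_m` starting from `z 0 = z_{m,1}`, `ρₙ = z n / a`, and
`𝒥ₙ(s) = J_m(ρₙ s)/√(N n)` with `N n = (a²/2) J_m'(z n)²`. -/
theorem besselJ_fourier_bessel_expansion
    (a : ℝ) (ha : 0 < a) (m : ℕ) (r : ℝ) (hr : 0 < r)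
    (z : ℕ → ℝ) (hmono : StrictMono z) (hpos : ∀ n, 0 < z n)
    (hzero : ∀ n, besselJ m (z n) = 0)
    (hall : ∀ x, 0 < x → besselJ m x = 0 → ∃ n, x = z n)
    (hra : besselJ m (a * r) ≠ 0) :
    Tendsto (fun k : ℕ =>
        eLpNorm (fun s : ℝ =>
            besselJ m (r * s) - Real.sqrt 2 * besselJ m (a * r) *
              ∑ n ∈ Finset.range k,
                (-1 : ℝ) ^ (n + 1) * (z n / a) *
                  (besselJ m ((z n / a) * s)
                      / Real.sqrt (a ^ 2 / 2 * (deriv (besselJ m) (z n)) ^ 2))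
                  / (r ^ 2 - (z n / a) ^ 2))
          2 ((volume.restrict (Set.Ioc (0:ℝ) a)).withDensity
                (fun s => ENNReal.ofReal s)))
      atTop (nhds 0) := by
  obtain ⟨c, hc, hJ⟩ := besselJ_eq m
  have hP : ∀ x, 0 < x → (besselJ m x = 0 ↔ bP m x = 0) := by
    intro x hx
    have := (pow_pos hx m).ne'
    rw [hJ]; simp [hc.ne', this]
  have hzero' : ∀ n, bP m (z n) = 0 := fun n => (hP _ (hpos n)).1 (hzero n)
  have hall' : ∀ x, 0 < x → bP m x = 0 → ∃ n, x = z n := fun x hx h => hall x hx ((hP x hx).2 h)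
  have hconv := conv_main a ha m z hmono hpos hzero' hall' (kf m r)
  have hza : ∀ n, z n / a * a = z n := fun n => div_mul_cancel₀ _ ha.ne'
  have hJd : ∀ n, deriv (besselJ m) (z n) = c * z n ^ m * bP' m (z n) := by
    intro n
    have hf : besselJ m = fun x => c * x ^ m * bP m x := funext hJ
    rw [hf]
    have := (((hasDerivAt_pow m (z n)).const_mul c).mul (bP_hd m (z n))).deriv
    refine this.trans ?_
    rw [hzero']; ring
  have hterm : ∀ k s, besselJ m (r * s) - Real.sqrt 2 * besselJ m (a * r) *
              ∑ n ∈ Finset.range k,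
                (-1 : ℝ) ^ (n + 1) * (z n / a) *
                  (besselJ m ((z n / a) * s)
                      / Real.sqrt (a ^ 2 / 2 * (deriv (besselJ m) (z n)) ^ 2))
                  / (r ^ 2 - (z n / a) ^ 2)
      = c * r ^ m * s ^ m * (resid (BB a m) (fun n => kf m (z n / a)) k (kf m r)).1 s := by
    intro k s
    have hres : (resid (BB a m) (fun n => kf m (z n / a)) k (kf m r)).1 s = bP m (r * s)
        - ∑ n ∈ Finset.range k, (BB a m (kf m r) (kf m (z n / a)) / BB a m (kf m (z n / a)) (kf m (z n / a))) * bP m (z n / a * s) := by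
      have : (resid (BB a m) (fun n => kf m (z n / a)) k (kf m r)).1 s = ev s (resid (BB a m) (fun n => kf m (z n / a)) k (kf m r)) := rfl
      rw [this, resid, map_sub, map_sum]
      simp only [map_smul]
      rfl
    rw [hres, mul_sub, Finset.mul_sum, Finset.mul_sum]
    congr 1
    · rw [hJ]; ring
    refine Finset.sum_congr rfl fun n _ => ?_
    have hz := hpos n
    have hsg := bP_sign m z hmono hpos hzero' hall' n
    have hp' := bP_simple m (z n) hz (hzero' n)
    have hne : r ^ 2 - (z n / a) ^ 2 ≠ 0 := by
      intro h
      have h1 : r = z n / a := by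
        have : 0 < z n / a := div_pos hz ha
        exact (pow_left_inj₀ hr.le this.le two_ne_zero).1 (sub_eq_zero.1 h)
      apply hra
      rw [h1, mul_comm, hza, hzero]
    have hL := BB_lommel a m r (z n / a) (by rw [hza, hzero'])
    rw [hza] at hL
    have hL' : BB a m (kf m r) (kf m (z n / a)) = a ^ (2 * m + 1) * (z n / a * bP' m (z n)) * bP m (r * a) / (r ^ 2 - (z n / a) ^ 2) := by
      rw [eq_div_iff hne, ← hL]; ring
    have hN := BB_kf_self a m (z n / a) (div_pos hz ha).ne' (by rw [hza, hzero'])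
    rw [hza] at hN
    rw [hL', hN, hJd]
    have hsq : Real.sqrt (a ^ 2 / 2 * (c * z n ^ m * bP' m (z n)) ^ 2) = a * (c * z n ^ m * ((-1) ^ (n+1) * bP' m (z n))) / Real.sqrt 2 := by
      have h2 : (0:ℝ) < Real.sqrt 2 := by positivity
      rw [Real.sqrt_eq_iff_mul_self_eq (by positivity) (by positivity)]
      have h3 : Real.sqrt 2 ^ 2 = 2 := Real.sq_sqrt (by norm_num)
      have h4 : ((-1 : ℝ) ^ (n+1)) ^ 2 = 1 := by rw [← pow_mul, mul_comm, pow_mul]; simp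
      have : a * (c * z n ^ m * ((-1) ^ (n+1) * bP' m (z n))) / Real.sqrt 2 * (a * (c * z n ^ m * ((-1) ^ (n+1) * bP' m (z n))) / Real.sqrt 2)
        = a ^ 2 * (c * z n ^ m * bP' m (z n)) ^ 2 * ((-1 : ℝ) ^ (n+1)) ^ 2 / Real.sqrt 2 ^ 2 := by ring
      rw [this, h3, h4]; ring
    rw [hsq, hJ, hJ]
    generalize hD : r ^ 2 - (z n / a) ^ 2 = Dn at hne ⊢
    have hs1 : ((-1 : ℝ) ^ (n+1)) ≠ 0 := by positivity
    generalize ((-1 : ℝ) ^ (n+1)) = sg at hs1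
    have h3 : Real.sqrt 2 ^ 2 = 2 := Real.sq_sqrt (by norm_num)
    have h2 : Real.sqrt 2 ≠ 0 := by positivity
    rw [mul_comm r a, mul_pow (z n / a), mul_pow a r, div_pow]
    generalize Real.sqrt 2 = q at h2 h3
    field_simp
    rw [h3]
    try ring
  simp only [hterm]
  have hnorm : ∀ k, eLpNorm (fun s => c * r ^ m * s ^ m * (resid (BB a m) (fun n => kf m (z n / a)) k (kf m r)).1 s) 2
      ((volume.restrict (Set.Ioc (0:ℝ) a)).withDensity (fun s => ENNReal.ofReal s))
      = (ENNReal.ofReal ((c * r ^ m) ^ 2 * BB a m (resid (BB a m) (fun n => kf m (z n / a)) k (kf m r))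
      (resid (BB a m) (fun n => kf m (z n / a)) k (kf m r)))) ^ (1 / 2 : ℝ) := by
    intro k
    rw [eLpNorm_eq a ha _ (by have := C1.cont (resid (BB a m) (fun n => kf m (z n / a)) k (kf m r)); fun_prop)]
    congr 2
    rw [BB_apply, ← intervalIntegral.integral_const_mul]
    congr 1; ext s; ring
  simp only [hnorm]
  have h1 := (ENNReal.tendsto_ofReal (hconv.const_mul ((c * r ^ m) ^ 2))).ennrpow_const (1 / 2 : ℝ)
  simpa using h1
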